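/- Let I be the interpreted system of the Counting FloodSet information exchange E^{count} under Crash_t, let r be a run of I and m a time, and suppose agent i's local state at (r,m) is r_i(m) = ⟨W, h, m, v_i⟩. Then (I,r,m) ⊨ C_N(∃0) ∨ C_N(∃1) if and only if m ≥ min{t+1, n−1} or h ≥ n−1. -/

import Mathlib

namespace SBA

/-- The set of values `{0,1}`; `false` plays the role of `0`, `true` of `1`. -/
abbrev Values := Bool

/-- Actions of an agent in the SBA problem: decide a value, or do nothing. -/
inductive Action where
  | decide (v : Values)
  | noop
deriving DecidableEq

/-- An adversary: `F m i j = false` means agent `i`'s round-`m` message to `j`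
is not delivered. -/
structure Adversary (n : ℕ) where
  F : ℕ → Fin n → Fin n → Bool

/-- Validity of an adversary for the crash failure model `Crash_t`:
crashes are permanent, an undelivered message means the sender has crashed,
and at most `t` agents are faulty. -/
def Adversary.Valid {n : ℕ} (A : Adversary n) (t : ℕ) : Prop :=
  (∀ m i, A.F m i i = false → ∀ m', m < m' → ∀ k, A.F m' i k = false) ∧
  (∀ m i j, A.F m i j = false → A.F m i i = false) ∧
  {i : Fin n | ∃ m j, A.F m i j = false}.ncard ≤ t

/-- An information exchange: local state types, message types, the special
`crashed` state, a (bijective) choice of initial state for each initial value,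
the message selection function `μ` and the state update function `δ`. -/
structure InfoExchange (n : ℕ) where
  L : Fin n → Type
  M : Fin n → Type
  crashSt : ∀ i, L i
  initSt : ∀ i, Values → L i
  initInj : ∀ i, Function.Injective (initSt i)
  μ : ∀ i, L i → Action → (Fin n → Option (M i))
  δ : ∀ i, L i → Adversary n → Action → ((j : Fin n) → Option (M j)) → L i

/-- A decision protocol for information exchange `E`: each agent maps its
local state to an action. -/
def DecProtocol {n : ℕ} (E : InfoExchange n) := ∀ i : Fin n, E.L i → Action

/-- A run: a (constant) environment state (the adversary) together with, for
each time, a local state for each agent. -/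
structure Run {n : ℕ} (E : InfoExchange n) where
  env : Adversary n
  st : ℕ → (i : Fin n) → E.L i

/-- The vector of messages received by agent `i` in round `k+1`. -/
def recvd {n : ℕ} (E : InfoExchange n) (P : DecProtocol E) (r : Run E) (k : ℕ)
    (i : Fin n) : (j : Fin n) → Option (E.M j) :=
  fun j => if r.env.F (k+1) j i = true
           then E.μ j (r.st k j) (P j (r.st k j)) i else none

/-- Agent `i` has not been crashed by the adversary up to (and including) round `m`. -/
def aliveAt {n : ℕ} (A : Adversary n) (m : ℕ) (i : Fin n) : Prop :=
  ∀ k ≤ m, A.F k i i = true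

instance {n : ℕ} (A : Adversary n) (m : ℕ) (i : Fin n) : Decidable (aliveAt A m i) := by
  unfold aliveAt; infer_instance

/-- `r` is a run generated by decision protocol `P` with information exchange `E`
in the crash failure context `Crash_t`. -/
def IsRun {n : ℕ} (E : InfoExchange n) (P : DecProtocol E) (t : ℕ) (r : Run E) : Prop :=
  r.env.Valid t ∧
  (∀ i, ∃ v, r.st 0 i = E.initSt i v) ∧
  ∀ k i, r.st (k+1) i =
    if aliveAt r.env (k+1) i
    then E.δ i (r.st k i) r.env (P i (r.st k i)) (recvd E P r k i)
    else E.crashSt i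

/-- The interpreted system `I_{P,E,Crash_t}`: the set of runs of `(P,E)` in `Crash_t`. -/
def Runs {n : ℕ} (E : InfoExchange n) (P : DecProtocol E) (t : ℕ) : Set (Run E) :=
  {r | IsRun E P t r}

/-- Agent `i` is nonfailed at the point `(r,m)`, i.e. `i ∈ N(r,m)`. -/
def Nonfailed {n : ℕ} (E : InfoExchange n) (r : Run E) (m : ℕ) (i : Fin n) : Prop :=
  r.st m i ≠ E.crashSt i

/-- (Semantic) formulas: predicates on points. -/
abbrev Form {n : ℕ} (E : InfoExchange n) := Run E → ℕ → Prop

/-- Knowledge: `K_i φ` holds at `(r,m)` iff `φ` holds at every point of the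
system `R` that is indistinguishable to agent `i` from `(r,m)`. -/
def Kn {n : ℕ} (E : InfoExchange n) (R : Set (Run E)) (i : Fin n) (φ : Form E) : Form E :=
  fun r m => ∀ r' ∈ R, ∀ m', r.st m i = r'.st m' i → φ r' m'

/-- `E_N φ`: every nonfailed agent knows `φ`. -/
def EvK {n : ℕ} (E : InfoExchange n) (R : Set (Run E)) (φ : Form E) : Form E :=
  fun r m => ∀ i, Nonfailed E r m i → Kn E R i φ r m

/-- Common knowledge among the nonfailed agents: `E_N^k φ` for all `k ≥ 1`. -/
def CK {n : ℕ} (E : InfoExchange n) (R : Set (Run E)) (φ : Form E) : Form E :=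
  fun r m => ∀ k : ℕ, (EvK E R)^[k+1] φ r m

/-- The atomic proposition `∃v`: some agent has initial value `v` in the run. -/
def ExistsVal {n : ℕ} (E : InfoExchange n) (v : Values) : Form E :=
  fun r _m => ∃ i, r.st 0 i = E.initSt i v

/-- Two runs (of possibly different information exchanges) correspond: same
adversary and the same initial values for all agents. -/
def Corresponds {n : ℕ} (E1 E2 : InfoExchange n) (r1 : Run E1) (r2 : Run E2) : Prop :=
  r1.env = r2.env ∧ ∀ i, ∃ v, r1.st 0 i = E1.initSt i v ∧ r2.st 0 i = E2.initSt i v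

/-- Agreement: nonfailed agents decide the same value. -/
def Agreement {n : ℕ} (E : InfoExchange n) (P : DecProtocol E) (t : ℕ) : Prop :=
  ∀ r ∈ Runs E P t, ∀ (m m' : ℕ) (i j : Fin n) (v v' : Values),
    Nonfailed E r m i → Nonfailed E r m' j →
    P i (r.st m i) = Action.decide v → P j (r.st m' j) = Action.decide v' → v = v'

/-- Validity: any value decided by a nonfailed agent is some agent's initial value. -/
def ValidityP {n : ℕ} (E : InfoExchange n) (P : DecProtocol E) (t : ℕ) : Prop :=
  ∀ r ∈ Runs E P t, ∀ (m : ℕ) (i : Fin n) (v : Values),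
    Nonfailed E r m i → P i (r.st m i) = Action.decide v →
    ∃ j, r.st 0 j = E.initSt j v

/-- Simultaneity: if a nonfailed agent decides in a round, every nonfailed agent
decides in that round. -/
def Simultaneity {n : ℕ} (E : InfoExchange n) (P : DecProtocol E) (t : ℕ) : Prop :=
  ∀ r ∈ Runs E P t, ∀ (m : ℕ) (i j : Fin n) (v : Values),
    Nonfailed E r m i → Nonfailed E r m j →
    P i (r.st m i) = Action.decide v → ∃ w, P j (r.st m j) = Action.decide w

/-- Termination: every agent eventually decides or fails. -/
def TerminationP {n : ℕ} (E : InfoExchange n) (P : DecProtocol E) (t : ℕ) : Prop :=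
  ∀ r ∈ Runs E P t, ∀ i : Fin n,
    (∃ m, ¬ Nonfailed E r m i) ∨ (∃ m v, P i (r.st m i) = Action.decide v)

/-- `(P,E)` is an SBA protocol in the crash failure context `Crash_t`. -/
def IsSBA {n : ℕ} (E : InfoExchange n) (P : DecProtocol E) (t : ℕ) : Prop :=
  Agreement E P t ∧ ValidityP E P t ∧ Simultaneity E P t ∧ TerminationP E P t

/-- `E` does not transmit information about actions. -/
def NoActionInfo {n : ℕ} (E : InfoExchange n) : Prop :=
  ∀ (i : Fin n) (s : E.L i) (a₁ a₂ : Action),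
    E.μ i s a₁ = E.μ i s a₂ ∧ ∀ A v, E.δ i s A a₁ v = E.δ i s A a₂ v

/-- The trivial decision protocol (used to form `I_E` for an information exchange
that does not transmit information about actions). -/
def noopProt {n : ℕ} (E : InfoExchange n) : DecProtocol E := fun _ _ => Action.noop

/-- The interpreted system `I_E` of an information exchange that does not
transmit information about actions. -/
def Sys {n : ℕ} (E : InfoExchange n) (t : ℕ) : Set (Run E) :=
  Runs E (noopProt E) t

end SBA
namespace SBA

/-- The number of agents from which no message was received. -/
def missingCount {n : ℕ} {M : Fin n → Type} (ms : (j : Fin n) → Option (M j)) : ℕ :=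
  (Finset.univ.filter (fun j => (ms j).isNone)).card

/-- Local states of the Counting FloodSet information exchange `E^count`. -/
inductive CountState where
  | crashed
  | live (W : Finset Bool) (h : ℕ) (m : ℕ) (v : Bool)
deriving DecidableEq

/-- The Counting FloodSet information exchange `E^count`. -/
def countE (n : ℕ) : InfoExchange n where
  L := fun _ => CountState
  M := fun _ => Finset Bool
  crashSt := fun _ => .crashed
  initSt := fun _ v => .live {v} 0 0 v
  initInj := by
    intro i v v' h
    injection h with h1 h2 h3 h4
  μ := fun _ s _ => match s with
    | .crashed => fun _ => none
    | .live W _ _ _ => fun _ => some W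
  δ := fun _ s _ _ ms => match s with
    | .crashed => .crashed
    | .live W _ m v =>
        .live (W ∪ Finset.univ.biUnion (fun j => (ms j).getD ∅))
          (missingCount ms) (m+1) v

end SBA
namespace SBA

section CommonKnowledge

variable {n : ℕ} {E : InfoExchange n} {R : Set (Run E)} {φ : Form E}

/-- Common knowledge follows from an invariant that implies `φ` and is preserved along
the indistinguishability relations of the nonfailed agents. -/
theorem CK.of_invariant (Ψ : Form E) (hφ : ∀ r m, Ψ r m → φ r m)
    (hstep : ∀ r m, Ψ r m → ∀ i, Nonfailed E r m i → ∀ r' ∈ R, ∀ m',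
      r.st m i = r'.st m' i → Ψ r' m')
    {r : Run E} {m : ℕ} (h : Ψ r m) : CK E R φ r m := by
  have key : ∀ k r m, Ψ r m → (EvK E R)^[k] φ r m := by
    intro k
    induction k with
    | zero => exact hφ
    | succ k ih =>
      intro r m h
      rw [Function.iterate_succ_apply']
      exact fun i hi r' hr' m' he => ih r' m' (hstep r m h i hi r' hr' m' he)
  exact fun k => key (k + 1) r m h

theorem CK.transfer {r r' : Run E} {m m' : ℕ} {i : Fin n} (h : CK E R φ r m)
    (hi : Nonfailed E r m i) (hr' : r' ∈ R) (he : r.st m i = r'.st m' i) :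
    CK E R φ r' m' := by
  intro k
  have := h (k + 1)
  rw [Function.iterate_succ_apply'] at this
  exact this i hi r' hr' m' he

theorem CK.holds {r : Run E} {m : ℕ} {i : Fin n} (h : CK E R φ r m)
    (hi : Nonfailed E r m i) (hr : r ∈ R) : φ r m :=
  h 0 i hi r hr m rfl

end CommonKnowledge

section Characterization

variable {n t : ℕ} {A : Adversary n}

/-- The values seen by an agent at a time, as long as it is not crashed. -/
def seen (A : Adversary n) (val : Fin n → Bool) : ℕ → Fin n → Finset Bool
  | 0, a => {val a}
  | k + 1, a => seen A val k a ∪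
      (Finset.univ.filter fun j => A.F (k + 1) j a = true).biUnion (seen A val k)

/-- The agents from which no message is received in the round ending at the given time. -/
def missing (A : Adversary n) : ℕ → Fin n → Finset (Fin n)
  | 0, _ => ∅
  | k + 1, a => Finset.univ.filter fun j => A.F (k + 1) j a = false

/-- The local state in `E^count` determined by an adversary and initial values. -/
def localState (A : Adversary n) (val : Fin n → Bool) (k : ℕ) (a : Fin n) : CountState :=
  if k = 0 ∨ aliveAt A k a then .live (seen A val k a) (missing A k a).card k (val a)
  else .crashed

theorem aliveAt.mono {k l : ℕ} {a : Fin n} (h : aliveAt A l a) (hkl : k ≤ l) : aliveAt A k a :=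
  fun j hj => h j (hj.trans hkl)

theorem Adversary.Valid.aliveAt_of_delivered (hA : A.Valid t) {k : ℕ} {j a : Fin n}
    (h : A.F (k + 1) j a = true) : aliveAt A k j := by
  intro l hl
  by_contra hc
  have := hA.1 l j (by simpa using hc) (k + 1) (by omega) a
  simp_all

theorem Adversary.Valid.delivered_of_aliveAt (hA : A.Valid t) {k : ℕ} {j : Fin n}
    (h : aliveAt A k j) (a : Fin n) : A.F k j a = true := by
  by_contra hc
  have := hA.2.1 k j a (by simpa using hc)
  have := h k le_rfl
  simp_all

theorem localState_succ (hA : A.Valid t) (val : Fin n → Bool) {k : ℕ} {a : Fin n}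
    (ha : aliveAt A (k + 1) a) :
    (countE n).δ a (localState A val k a) A Action.noop
      (fun j => if A.F (k + 1) j a = true
        then (countE n).μ j (localState A val k j) Action.noop a else none) =
    localState A val (k + 1) a := by
  have hmsg : (fun j => if A.F (k + 1) j a = true
        then (countE n).μ j (localState A val k j) Action.noop a else none) =
      fun j => if A.F (k + 1) j a = true then some (seen A val k j) else none := by
    funext j
    split_ifs with h
    · simp [localState, hA.aliveAt_of_delivered h, countE]
    · rfl
  rw [hmsg]
  have hk : aliveAt A k a := ha.mono (Nat.le_succ k)
  simp only [localState, hk, ha, or_true, if_true, countE, seen, missing, missingCount]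
  congr 2
  · ext x
    simp only [Finset.mem_biUnion, Finset.mem_univ, true_and, Finset.mem_filter]
    refine exists_congr fun j => ?_
    split_ifs with h <;> simp [h]
  · ext j
    simp only [Finset.mem_filter, Finset.mem_univ, true_and]
    split_ifs with h <;> simp [h]

/-- The run of `E^count` with a given adversary and given initial values. -/
def runOf (A : Adversary n) (val : Fin n → Bool) : Run (countE n) where
  env := A
  st := localState A val

theorem runOf_mem (hA : A.Valid t) (val : Fin n → Bool) :
    runOf A val ∈ Sys (countE n) t := by
  refine ⟨hA, fun i => ⟨val i, by simp [runOf, localState, countE, seen, missing]⟩, ?_⟩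
  intro k i
  show localState A val (k + 1) i = _
  split_ifs with h
  · exact (localState_succ hA val h).symm
  · have h : ¬ aliveAt A (k + 1) i := h
    simp [localState, h, countE]

theorem exists_st_eq_localState {r : Run (countE n)} (hr : r ∈ Sys (countE n) t) :
    ∃ val : Fin n → Bool, ∀ k a, r.st k a = localState r.env val k a := by
  obtain ⟨hA, h0, hs⟩ := hr
  choose val hval using h0
  refine ⟨val, fun k => ?_⟩
  induction k with
  | zero => intro a; rw [hval]; simp [localState, countE, seen, missing]
  | succ k ih =>
    intro a
    rw [hs]
    split_ifs with h
    · rw [← localState_succ hA val h, ih a]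
      unfold recvd
      simp only [ih]
      rfl
    · simp [localState, h, countE]

theorem self_mem_seen (A : Adversary n) (val : Fin n → Bool) (k : ℕ) (a : Fin n) :
    val a ∈ seen A val k a := by
  induction k with
  | zero => simp [seen]
  | succ k ih => exact Finset.mem_union_left _ ih

theorem seen_subset_seen_succ {val : Fin n → Bool} {k : ℕ} {j a : Fin n}
    (h : A.F (k + 1) j a = true) : seen A val k j ⊆ seen A val (k + 1) a := by
  intro x hx
  refine Finset.mem_union_right _ (Finset.mem_biUnion.2 ⟨j, by simpa using h, hx⟩)

theorem exists_val_of_mem_seen {val : Fin n → Bool} {k : ℕ} {a : Fin n} {x : Bool}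
    (h : x ∈ seen A val k a) : ∃ j, val j = x := by
  induction k generalizing a with
  | zero => exact ⟨a, by simpa [seen, eq_comm] using h⟩
  | succ k ih =>
    simp only [seen, Finset.mem_union, Finset.mem_biUnion] at h
    rcases h with h | ⟨j, -, h⟩ <;> exact ih h

theorem seen_const (A : Adversary n) (w : Bool) (k : ℕ) (a : Fin n) :
    seen A (fun _ => w) k a = {w} := by
  ext x
  rw [Finset.mem_singleton]
  constructor
  · intro h
    obtain ⟨_, rfl⟩ := exists_val_of_mem_seen h
    rfl
  · rintro rfl
    exact self_mem_seen A _ k a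

theorem seen_eq_univ {val : Fin n → Bool} {k : ℕ} {a : Fin n} {x : Bool}
    (h : x ∈ seen A val k a) (h' : (!x) ∈ seen A val k a) : seen A val k a = Finset.univ := by
  ext y
  cases x <;> cases y <;> simp_all

theorem localState_eq_live {val : Fin n → Bool} {k k' h : ℕ} {a : Fin n} {W : Finset Bool}
    {v : Bool} :
    localState A val k a = .live W h k' v ↔ (k = 0 ∨ aliveAt A k a) ∧ seen A val k a = W ∧
      (missing A k a).card = h ∧ k = k' ∧ val a = v := by
  unfold localState
  split_ifs with hc <;> simp [hc]

theorem localState_ne_crashed {val : Fin n → Bool} {k : ℕ} {a : Fin n} :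
    localState A val k a ≠ .crashed ↔ k = 0 ∨ aliveAt A k a := by
  unfold localState
  split_ifs with hc <;> simp [hc]

end Characterization

section Agreement

variable {n t : ℕ} {A : Adversary n}

theorem seen_eq_of_clean_round (hA : A.Valid t) (val : Fin n → Bool) {k : ℕ}
    (hc : ∀ a, aliveAt A k a → aliveAt A (k + 1) a) {m : ℕ} (hm : k + 1 ≤ m) :
    ∀ a b, aliveAt A m a → aliveAt A m b → seen A val m a = seen A val m b := by
  induction m, hm using Nat.le_induction with
  | base =>
    have key : ∀ a b, aliveAt A (k + 1) a → seen A val (k + 1) a ⊆ seen A val (k + 1) b := by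
      intro a b ha x hx
      simp only [seen, Finset.mem_union, Finset.mem_biUnion, Finset.mem_filter,
        Finset.mem_univ, true_and] at hx
      rcases hx with hx | ⟨j, hj, hx⟩
      · exact seen_subset_seen_succ (hA.delivered_of_aliveAt ha b) hx
      · exact seen_subset_seen_succ
          (hA.delivered_of_aliveAt (hc j (hA.aliveAt_of_delivered hj)) b) hx
    exact fun a b ha hb => (key a b ha).antisymm (key b a hb)
  | succ m hm ih =>
    have key : ∀ a b, aliveAt A (m + 1) a → aliveAt A (m + 1) b →
        seen A val (m + 1) a ⊆ seen A val (m + 1) b := by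
      intro a b ha hb x hx
      have hb' := hb.mono (Nat.le_succ m)
      simp only [seen, Finset.mem_union, Finset.mem_biUnion, Finset.mem_filter,
        Finset.mem_univ, true_and] at hx
      refine Finset.mem_union_left _ ?_
      rcases hx with hx | ⟨j, hj, hx⟩
      · rwa [ih b a hb' (ha.mono (Nat.le_succ m))]
      · rwa [ih b j hb' (hA.aliveAt_of_delivered hj)]
    exact fun a b ha hb => (key a b ha hb).antisymm (key b a hb ha)

theorem card_alive_add_le {m : ℕ}
    (hc : ∀ k < m, ∃ a, aliveAt A k a ∧ ¬ aliveAt A (k + 1) a) :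
    (Finset.univ.filter fun a => aliveAt A m a).card + m ≤ n := by
  induction m with
  | zero => simpa using Finset.card_le_univ (Finset.univ.filter fun a => aliveAt A 0 a)
  | succ m ih =>
    obtain ⟨a, ha, ha'⟩ := hc m (Nat.lt_succ_self m)
    have := ih fun k hk => hc k (by omega)
    have hlt : (Finset.univ.filter fun a => aliveAt A (m + 1) a).card <
        (Finset.univ.filter fun a => aliveAt A m a).card := by
      refine Finset.card_lt_card (Finset.ssubset_iff_of_subset ?_ |>.2 ⟨a, ?_, ?_⟩)
      · intro b hb
        simp only [Finset.mem_filter, Finset.mem_univ, true_and] at hb ⊢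
        exact hb.mono (Nat.le_succ m)
      · simpa using ha
      · simpa using ha'
    omega

theorem Adversary.Valid.le_card_alive (hA : A.Valid t) (m : ℕ) :
    n ≤ (Finset.univ.filter fun a => aliveAt A m a).card + t := by
  classical
  have hle : (Finset.univ.filter fun a => ¬ aliveAt A m a).card ≤ t := by
    rw [← Set.ncard_coe_finset]
    refine (Set.ncard_le_ncard ?_ (Set.toFinite _)).trans hA.2.2
    intro a ha
    simp only [Finset.coe_filter, Finset.mem_univ, true_and, Set.mem_ofPred_eq, aliveAt,
      not_forall] at ha
    obtain ⟨k, -, hk⟩ := ha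
    exact ⟨k, a, by simpa using hk⟩
  have := Finset.card_filter_add_card_filter_not (s := (Finset.univ : Finset (Fin n)))
    (fun a => aliveAt A m a)
  simp only [Finset.card_univ, Fintype.card_fin] at this
  omega

theorem seen_eq_of_min_le (hA : A.Valid t) (val : Fin n → Bool) {m : ℕ}
    (hm : min (t + 1) (n - 1) ≤ m) {a b : Fin n} (ha : m = 0 ∨ aliveAt A m a)
    (hb : m = 0 ∨ aliveAt A m b) : seen A val m a = seen A val m b := by
  rcases Nat.eq_zero_or_pos m with rfl | hpos
  · have : a = b := by ext; omega
    rw [this]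
  replace ha : aliveAt A m a := ha.resolve_left hpos.ne'
  replace hb : aliveAt A m b := hb.resolve_left hpos.ne'
  by_cases hc : ∀ k < m, ∃ a, aliveAt A k a ∧ ¬ aliveAt A (k + 1) a
  · have h1 := card_alive_add_le hc
    have h2 := hA.le_card_alive m
    have h3 : (Finset.univ.filter fun a => aliveAt A m a).card ≤ 1 := by omega
    rw [Finset.card_le_one.1 h3 a (by simpa using ha) b (by simpa using hb)]
  · push Not at hc
    obtain ⟨k, hk, hc⟩ := hc
    exact seen_eq_of_clean_round hA val hc hk a b ha hb

theorem eq_of_le_card_missing (hA : A.Valid t) {m : ℕ} {i j : Fin n}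
    (hi : m = 0 ∨ aliveAt A m i) (h : n - 1 ≤ (missing A m i).card)
    (hj : m = 0 ∨ aliveAt A m j) : j = i := by
  cases m with
  | zero => simp only [missing, Finset.card_empty] at h; ext; omega
  | succ k =>
    by_contra hne
    replace hi := hi.resolve_left k.succ_ne_zero
    replace hj := hj.resolve_left k.succ_ne_zero
    have hsub : missing A (k + 1) i ⊆ (Finset.univ.erase i).erase j := by
      intro x hx
      simp only [missing, Finset.mem_filter, Finset.mem_univ, true_and] at hx
      simp only [Finset.mem_erase, Finset.mem_univ, and_true]
      constructor
      · rintro rfl; simp [hA.delivered_of_aliveAt hj] at hx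
      · rintro rfl; simp [hA.delivered_of_aliveAt hi] at hx
    have := Finset.card_le_card hsub
    rw [Finset.card_erase_of_mem (by simp [hne]), Finset.card_erase_of_mem (by simp)] at this
    simp only [Finset.card_univ, Fintype.card_fin] at this
    have := i.2
    have := j.2
    have : (i : ℕ) ≠ j := fun e => hne (Fin.ext e.symm)
    omega

theorem Adversary.Valid.card_missing_le (hA : A.Valid t) (m : ℕ) (i : Fin n) :
    (missing A m i).card ≤ t := by
  cases m with
  | zero => simp [missing]
  | succ k =>
    rw [← Set.ncard_coe_finset]
    refine (Set.ncard_le_ncard ?_ (Set.toFinite _)).trans hA.2.2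
    intro a ha
    exact ⟨k + 1, i, by simpa [missing] using ha⟩

end Agreement

section Adversaries

variable {n t : ℕ}

/-- The agents in `H` crash in round `m`, and only `i` misses their messages of that round. -/
def lateCrash (m : ℕ) (H : Finset (Fin n)) (i : Fin n) : Adversary n where
  F k a b := decide (a ∉ H ∨ k < m ∨ (k = m ∧ b ≠ i ∧ b ≠ a))

theorem lateCrash_valid (m : ℕ) {H : Finset (Fin n)} (i : Fin n) (hH : H.card ≤ t) :
    (lateCrash m H i).Valid t := by
  refine ⟨fun k a h k' hk b => ?_, fun k a b h => ?_, ?_⟩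
  · simp only [lateCrash, decide_eq_false_iff_not] at h ⊢
    grind
  · simp only [lateCrash, decide_eq_false_iff_not] at h ⊢
    grind
  · rw [← Set.ncard_coe_finset] at hH
    refine (Set.ncard_le_ncard ?_ (Set.toFinite _)).trans hH
    rintro a ⟨k, b, h⟩
    simp only [lateCrash, decide_eq_false_iff_not] at h
    exact by_contra fun hc => h (Or.inl hc)

theorem lateCrash_delivered {m : ℕ} {H : Finset (Fin n)} {a : Fin n} (i : Fin n) (ha : a ∉ H)
    (k : ℕ) (b : Fin n) : (lateCrash m H i).F k a b = true := by
  simp [lateCrash, ha]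

theorem missing_lateCrash_self {m : ℕ} (hm : m ≠ 0) (H : Finset (Fin n)) (i : Fin n) :
    missing (lateCrash m H i) m i = H := by
  obtain ⟨k, rfl⟩ := Nat.exists_eq_succ_of_ne_zero hm
  ext x
  simp [missing, lateCrash]

theorem missing_lateCrash_of_ne {m : ℕ} {H : Finset (Fin n)} {i j : Fin n} (hij : j ≠ i)
    (hj : j ∉ H) : missing (lateCrash m H i) m j = ∅ := by
  cases m with
  | zero => rfl
  | succ k =>
    ext x
    simp only [missing, lateCrash, Finset.mem_filter, Finset.mem_univ, true_and,
      decide_eq_false_iff_not, Finset.notMem_empty, iff_false, not_not]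
    grind

/-- The agents of rank `q < m` crash in round `q + 1`, when they reach only rank `q + 1`. -/
def crashChain (m : ℕ) (e : Equiv.Perm (Fin n)) : Adversary n where
  F k a b := decide (m ≤ (e a : ℕ) ∨ k ≤ (e a : ℕ) ∨ (k = (e a : ℕ) + 1 ∧ (e b : ℕ) = k))

theorem card_filter_perm_lt (e : Equiv.Perm (Fin n)) {q : ℕ} (hq : q ≤ n) :
    (Finset.univ.filter fun a => (e a : ℕ) < q).card = q := by
  have : (Finset.univ.filter fun a => (e a : ℕ) < q).card =
      (Finset.univ.filter fun a : Fin n => (a : ℕ) < q).card := by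
    refine Finset.card_bij (fun a _ => e a) ?_ ?_ ?_
    · simp
    · simp
    · intro b hb
      exact ⟨e.symm b, by simpa using hb, by simp⟩
  rw [this, Fin.card_filter_val_lt, min_eq_right hq]

theorem crashChain_valid {m : ℕ} (e : Equiv.Perm (Fin n)) (hm : m ≤ t) (hn : m ≤ n) :
    (crashChain m e).Valid t := by
  refine ⟨fun k a h k' hk b => ?_, fun k a b h => ?_, ?_⟩
  · simp only [crashChain, decide_eq_false_iff_not] at h ⊢
    omega
  · simp only [crashChain, decide_eq_false_iff_not] at h ⊢
    omega
  · refine le_trans ?_ ((card_filter_perm_lt e hn).trans_le hm)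
    rw [← Set.ncard_coe_finset]
    refine Set.ncard_le_ncard ?_ (Set.toFinite _)
    rintro a ⟨k, b, h⟩
    simp only [crashChain, decide_eq_false_iff_not] at h
    simp only [Finset.coe_filter, Finset.mem_univ, true_and, Set.mem_ofPred_eq]
    omega

theorem seen_crashChain_of_lt {m : ℕ} (e : Equiv.Perm (Fin n)) {val : Fin n → Bool} {w : Bool}
    (hval : ∀ a, (e a : ℕ) ≠ 0 → val a = w) {k : ℕ} (hk : k ≤ m) :
    ∀ a, k < (e a : ℕ) → seen (crashChain m e) val k a = {w} := by
  induction k with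
  | zero => intro a ha; simp [seen, hval a (by omega)]
  | succ k ih =>
    intro a ha
    refine (Finset.eq_singleton_iff_unique_mem).2 ⟨?_, ?_⟩
    · rw [← hval a (by omega)]
      exact self_mem_seen _ _ _ _
    · intro x hx
      simp only [seen, Finset.mem_union, Finset.mem_biUnion, Finset.mem_filter,
        Finset.mem_univ, true_and, crashChain, decide_eq_true_eq] at hx
      rcases hx with hx | ⟨j, hj, hx⟩
      · simpa using (ih (by omega) a (by omega)).subset hx
      · simpa using (ih (by omega) j (by omega)).subset hx

theorem mem_seen_crashChain_of_eq {m : ℕ} (e : Equiv.Perm (Fin n)) {val : Fin n → Bool}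
    {x : Bool} (hval : ∀ a, (e a : ℕ) = 0 → val a = x) (k : ℕ) :
    ∀ a, (e a : ℕ) = k → x ∈ seen (crashChain m e) val k a := by
  induction k with
  | zero => intro a ha; simp [seen, hval a ha]
  | succ k ih =>
    intro a ha
    obtain ⟨j, hj⟩ := e.surjective ⟨k, by omega⟩
    have hj' : (e j : ℕ) = k := by rw [hj]
    refine seen_subset_seen_succ (j := j) ?_ (ih j hj')
    simp [crashChain, hj', ha]

theorem exists_perm_pair {b c x y : Fin n} (hbc : b ≠ c) (hxy : x ≠ y) :
    ∃ e : Equiv.Perm (Fin n), e b = x ∧ e c = y := by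
  refine ⟨(Equiv.swap b x).trans (Equiv.swap (Equiv.swap b x c) y), ?_, ?_⟩
  · rw [Equiv.trans_apply, Equiv.swap_apply_left]
    refine Equiv.swap_apply_of_ne_of_ne (fun h => hbc ?_) hxy
    apply (Equiv.swap b x).injective
    rw [Equiv.swap_apply_left, ← h]
  · simp

end Adversaries

section Connectivity

variable {n t m : ℕ}

/-- Common knowledge of `φ` holds at some point where agent `i` has local state `s`. -/
def CKAt (t m : ℕ) (φ : Form (countE n)) (i : Fin n) (s : CountState) : Prop :=
  ∃ r ∈ Sys (countE n) t, r.st m i = s ∧ CK (countE n) (Sys (countE n) t) φ r m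

variable {φ : Form (countE n)}

theorem CKAt.transfer {i j : Fin n} {W : Finset Bool} {h k : ℕ} {v : Bool} {s : CountState}
    (H : CKAt t m φ i (.live W h k v)) {A : Adversary n} (hA : A.Valid t) (val : Fin n → Bool)
    (hi : localState A val m i = .live W h k v) (hj : localState A val m j = s) :
    CKAt t m φ j s := by
  obtain ⟨r, hr, hs, hck⟩ := H
  refine ⟨runOf A val, runOf_mem hA val, hj, hck.transfer (i := i) ?_ (runOf_mem hA val) ?_⟩
  · rw [Nonfailed, hs]
    exact fun h => CountState.noConfusion h
  · rw [hs]
    exact hi.symm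

theorem exists_card_eq_notMem_pair {h : ℕ} {i j : Fin n} (hij : i ≠ j) (hh : h + 2 ≤ n) :
    ∃ H : Finset (Fin n), H.card = h ∧ i ∉ H ∧ j ∉ H := by
  have hc : h ≤ ((Finset.univ.erase i).erase j).card := by
    rw [Finset.card_erase_of_mem (by simp [hij.symm]), Finset.card_erase_of_mem (by simp)]
    simp only [Finset.card_univ, Fintype.card_fin]
    omega
  obtain ⟨H, hsub, hcard⟩ := Finset.exists_subset_card_eq hc
  refine ⟨H, hcard, fun hi => ?_, fun hj => ?_⟩
  · exact Finset.notMem_erase i _ (Finset.mem_of_mem_erase (hsub hi))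
  · exact Finset.notMem_erase j _ (hsub hj)

theorem exists_run_univ (hm : m ≠ 0) {h : ℕ} (ht : h ≤ t) (hn : h + 2 ≤ n) {i j : Fin n}
    (hij : i ≠ j) (v : Bool) : ∃ (A : Adversary n) (val : Fin n → Bool), A.Valid t ∧
      localState A val m i = .live Finset.univ h m v ∧
      localState A val m j = .live Finset.univ 0 m (!v) := by
  obtain ⟨H, hcard, hi, hj⟩ := exists_card_eq_notMem_pair hij hn
  obtain ⟨k, rfl⟩ := Nat.exists_eq_succ_of_ne_zero hm
  set A := lateCrash (k + 1) H i
  let val : Fin n → Bool := fun a => if a = i then v else !v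
  have hvi : val i = v := by simp [val]
  have hvj : val j = !v := by simp [val, hij.symm]
  have hsi : ∀ a, v ∈ seen A val (k + 1) a := fun a =>
    seen_subset_seen_succ (lateCrash_delivered i hi _ a) (hvi ▸ self_mem_seen A val k i)
  have hsj : ∀ a, (!v) ∈ seen A val (k + 1) a := fun a =>
    seen_subset_seen_succ (lateCrash_delivered i hj _ a) (hvj ▸ self_mem_seen A val k j)
  refine ⟨A, val, lateCrash_valid _ _ (hcard.trans_le ht), ?_, ?_⟩
  · exact localState_eq_live.2 ⟨Or.inr fun l _ => lateCrash_delivered i hi l i,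
      seen_eq_univ (hsi i) (hsj i), by rw [missing_lateCrash_self hm, hcard], rfl, hvi⟩
  · exact localState_eq_live.2 ⟨Or.inr fun l _ => lateCrash_delivered i hj l j,
      seen_eq_univ (hsi j) (hsj j), by rw [missing_lateCrash_of_ne hij.symm hj]; rfl, rfl, hvj⟩

theorem exists_run_const (hm : m ≠ 0) {h : ℕ} (ht : h ≤ t) (hn : h + 2 ≤ n) {i j : Fin n}
    (hij : i ≠ j) (v : Bool) : ∃ A : Adversary n, A.Valid t ∧
      localState A (fun _ => v) m i = .live {v} h m v ∧
      localState A (fun _ => v) m j = .live {v} 0 m v := by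
  obtain ⟨H, hcard, hi, hj⟩ := exists_card_eq_notMem_pair hij hn
  refine ⟨lateCrash m H i, lateCrash_valid _ _ (hcard.trans_le ht), ?_, ?_⟩
  · exact localState_eq_live.2 ⟨Or.inr fun l _ => lateCrash_delivered i hi l i,
      seen_const _ _ _ _, by rw [missing_lateCrash_self hm, hcard], rfl, rfl⟩
  · exact localState_eq_live.2 ⟨Or.inr fun l _ => lateCrash_delivered i hj l j,
      seen_const _ _ _ _, by rw [missing_lateCrash_of_ne hij.symm hj]; rfl, rfl, rfl⟩

theorem exists_run_chain (hm : m ≠ 0) (ht : m ≤ t) (hn : m + 2 ≤ n) {b c : Fin n}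
    (hbc : b ≠ c) (w : Bool) : ∃ (A : Adversary n) (val : Fin n → Bool), A.Valid t ∧
      localState A val m b = .live Finset.univ (m - 1) m w ∧
      localState A val m c = .live {w} m m w := by
  obtain ⟨e, heb, hec⟩ := exists_perm_pair (x := ⟨m, by omega⟩) (y := ⟨m + 1, by omega⟩) hbc
    (by simp)
  replace heb : (e b : ℕ) = m := by rw [heb]
  replace hec : (e c : ℕ) = m + 1 := by rw [hec]
  let val : Fin n → Bool := fun a => if (e a : ℕ) = 0 then !w else w
  have hvb : val b = w := by simp [val, heb, hm]
  have hvc : val c = w := by simp [val, hec]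
  have halive : ∀ a, m ≤ (e a : ℕ) → aliveAt (crashChain m e) m a := fun a ha k _ => by
    simp [crashChain, ha]
  refine ⟨crashChain m e, val, crashChain_valid e ht (by omega), ?_, ?_⟩
  · refine localState_eq_live.2 ⟨Or.inr (halive b heb.ge), ?_, ?_, rfl, hvb⟩
    · refine seen_eq_univ (x := w) (hvb ▸ self_mem_seen _ val m b) ?_
      exact mem_seen_crashChain_of_eq e (fun a ha => by simp [val, ha]) m b heb
    · rw [← card_filter_perm_lt e (q := m - 1) (by omega)]
      obtain ⟨k, rfl⟩ := Nat.exists_eq_succ_of_ne_zero hm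
      congr 1
      ext x
      simp only [missing, crashChain, Finset.mem_filter, Finset.mem_univ, true_and,
        decide_eq_false_iff_not]
      omega
  · refine localState_eq_live.2 ⟨Or.inr (halive c (by omega)), ?_, ?_, rfl, hvc⟩
    · exact seen_crashChain_of_lt e (fun a ha => by simp [val, ha]) le_rfl c (by omega)
    · refine Eq.trans ?_ (card_filter_perm_lt e (q := m) (by omega))
      obtain ⟨k, rfl⟩ := Nat.exists_eq_succ_of_ne_zero hm
      congr 1
      ext x
      simp only [missing, crashChain, Finset.mem_filter, Finset.mem_univ, true_and,
        decide_eq_false_iff_not]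
      omega

theorem not_existsVal_runOf_const (A : Adversary n) (w : Bool) (m : ℕ) :
    ¬ ExistsVal (countE n) (!w) (runOf A fun _ => w) m := by
  rintro ⟨i, hi⟩
  simp [runOf, localState, countE, seen, missing] at hi

theorem not_CKAt_of_const {A : Adversary n} (hA : A.Valid t) {i : Fin n} {W : Finset Bool}
    {h k : ℕ} {v w : Bool} (hi : localState A (fun _ => w) m i = .live W h k v) :
    ¬ CKAt t m (ExistsVal (countE n) (!w)) i (.live W h k v) := by
  rintro ⟨r, hr, hs, hck⟩
  refine not_existsVal_runOf_const A w m (hck 0 i ?_ _ (runOf_mem hA _) m ?_)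
  · rw [Nonfailed, hs]
    exact fun h => CountState.noConfusion h
  · rw [hs]
    exact hi.symm

theorem not_CKAt_zero (hn : 2 ≤ n) {i : Fin n} {h k : ℕ} {W : Finset Bool} {v w : Bool} :
    ¬ CKAt t 0 (ExistsVal (countE n) (!w)) i (.live W h k v) := by
  intro H
  have : Nontrivial (Fin n) := Fin.nontrivial_iff_two_le.2 hn
  obtain ⟨j, hj⟩ := exists_ne i
  obtain ⟨r, hr, hs, -⟩ := id H
  obtain ⟨val, hval⟩ := exists_st_eq_localState hr
  replace hs := localState_eq_live.1 ((hval _ _).symm.trans hs)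
  obtain ⟨-, rfl, rfl, rfl, rfl⟩ := hs
  have hA : (lateCrash 0 ∅ i).Valid t := lateCrash_valid 0 i (by simp)
  refine not_CKAt_of_const (A := lateCrash 0 ∅ i) (i := j) (W := {w}) (h := 0) (k := 0) (v := w)
    hA (by simp [localState, seen, missing])
    (H.transfer hA (fun a => if a = i then val i else w) ?_ ?_)
  · simp [localState, seen, missing]
  · simp [localState, seen, missing, hj]

theorem not_CKAt_pos (hm : m ≠ 0) (ht : m ≤ t) (hn : m + 2 ≤ n) {i : Fin n} {h : ℕ}
    (hht : h ≤ t) (hhn : h + 2 ≤ n) {W : Finset Bool} {v w : Bool} (hv : v ∈ W) :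
    ¬ CKAt t m (ExistsVal (countE n) (!w)) i (.live W h m v) := by
  have : Nontrivial (Fin n) := Fin.nontrivial_iff_two_le.2 (by omega)
  have single : ∀ (i : Fin n) h, h ≤ t → h + 2 ≤ n →
      ¬ CKAt t m (ExistsVal (countE n) (!w)) i (.live {w} h m w) := by
    intro i h hht hhn
    obtain ⟨j, hj⟩ := exists_ne i
    obtain ⟨A, hA, hi, -⟩ := exists_run_const hm hht hhn hj.symm w
    exact not_CKAt_of_const hA hi
  have univ_same : ∀ (i : Fin n) h, h ≤ t → h + 2 ≤ n →
      ¬ CKAt t m (ExistsVal (countE n) (!w)) i (.live Finset.univ h m w) := by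
    intro i h hht hhn H
    obtain ⟨j, hj⟩ := exists_ne i
    obtain ⟨A₁, val₁, hA₁, hi₁, hj₁⟩ := exists_run_univ hm hht hhn hj.symm w
    obtain ⟨A₂, val₂, hA₂, hi₂, hj₂⟩ :=
      exists_run_univ (h := m - 1) hm (by omega : m - 1 ≤ t) (by omega) hj.symm w
    obtain ⟨A₃, val₃, hA₃, hi₃, hj₃⟩ := exists_run_chain hm ht hn hj.symm w
    exact single j m ht hn
      (((H.transfer hA₁ val₁ hi₁ hj₁).transfer hA₂ val₂ hj₂ hi₂).transfer hA₃ val₃ hi₃ hj₃)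
  have univ_any : ∀ (i : Fin n) h v, h ≤ t → h + 2 ≤ n →
      ¬ CKAt t m (ExistsVal (countE n) (!w)) i (.live Finset.univ h m v) := by
    intro i h v hht hhn H
    by_cases hvw : v = w
    · exact univ_same i h hht hhn (hvw ▸ H)
    · obtain ⟨j, hj⟩ := exists_ne i
      obtain ⟨A, val, hA, hi, hj'⟩ := exists_run_univ hm hht hhn hj.symm v
      have hvw' : (!v) = w := by cases v <;> cases w <;> simp_all
      exact univ_same j 0 (by omega) (by omega) (hvw' ▸ H.transfer hA val hi hj')
  intro H
  by_cases hW : (!v) ∈ W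
  · have : W = Finset.univ := by ext x; cases x <;> cases v <;> simp_all
    exact univ_any i h v hht hhn (this ▸ H)
  · have hWv : W = {v} := by ext x; cases x <;> cases v <;> simp_all
    subst hWv
    obtain ⟨j, hj⟩ := exists_ne i
    obtain ⟨A₁, hA₁, hi₁, hj₁⟩ := exists_run_const hm hht hhn hj.symm v
    obtain ⟨A₂, hA₂, hi₂, hj₂⟩ := exists_run_const hm ht hn hj.symm v
    obtain ⟨A₃, val₃, hA₃, hj₃, hi₃⟩ := exists_run_chain hm ht hn hj v
    exact univ_any j (m - 1) v (by omega) (by omega)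
      (((H.transfer hA₁ _ hi₁ hj₁).transfer hA₂ _ hj₂ hi₂).transfer hA₃ val₃ hi₃ hj₃)

end Connectivity

theorem existsVal_of_mem_seen {n : ℕ} {r : Run (countE n)} {val : Fin n → Bool}
    (hval : ∀ k a, r.st k a = localState r.env val k a) {m k : ℕ} {a : Fin n} {x : Bool}
    (hx : x ∈ seen r.env val k a) : ExistsVal (countE n) x r m := by
  obtain ⟨j, rfl⟩ := exists_val_of_mem_seen hx
  exact ⟨j, by rw [hval]; simp [localState, countE, seen, missing]⟩

/-- From time `min (t + 1) (n - 1)` on, the nonfailed agents agree on the values they have seen,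
so that these values are common knowledge. -/
theorem CK_existsVal_of_min_le {n t : ℕ} {r : Run (countE n)} (hr : r ∈ Sys (countE n) t)
    {m : ℕ} (hm : min (t + 1) (n - 1) ≤ m) {i : Fin n} {W : Finset Bool} {h k : ℕ} {v x : Bool}
    (hst : r.st m i = CountState.live W h k v) (hx : x ∈ W) :
    CK (countE n) (Sys (countE n) t) (ExistsVal (countE n) x) r m := by
  refine CK.of_invariant (fun r m => r ∈ Sys (countE n) t ∧ min (t + 1) (n - 1) ≤ m ∧
    ∃ i W h k v, r.st m i = CountState.live W h k v ∧ x ∈ W) ?_ ?_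
    ⟨hr, hm, i, W, h, k, v, hst, hx⟩
  · rintro r m ⟨hr, -, i, W, h, k, v, hst, hx⟩
    obtain ⟨val, hval⟩ := exists_st_eq_localState hr
    replace hst := localState_eq_live.1 ((hval _ _).symm.trans hst)
    exact existsVal_of_mem_seen hval (hst.2.1 ▸ hx)
  · rintro r m ⟨hr, hm, i, W, h, k, v, hst, hx⟩ j hj r' hr' m' he
    obtain ⟨val, hval⟩ := exists_st_eq_localState hr
    obtain ⟨val', hval'⟩ := exists_st_eq_localState hr'
    replace hst := localState_eq_live.1 ((hval _ _).symm.trans hst)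
    replace hj := localState_ne_crashed.1 ((hval m j).symm.trans_ne hj)
    have hst' : localState r.env val m j =
        .live (seen r.env val m j) (missing r.env m j).card m (val j) :=
      localState_eq_live.2 ⟨hj, rfl, rfl, rfl, rfl⟩
    replace he := he.symm.trans ((hval m j).trans hst')
    have he' := localState_eq_live.1 ((hval' _ _).symm.trans he)
    obtain rfl := he'.2.2.2.1
    refine ⟨hr', hm, j, _, _, _, _, he, ?_⟩
    rwa [seen_eq_of_min_le hr.1 val hm hj hst.1, hst.2.1]

/-- An agent that hears from nobody else is the only nonfailed agent, so that its initial value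
is common knowledge. -/
theorem CK_existsVal_of_le_missing {n t : ℕ} {r : Run (countE n)} (hr : r ∈ Sys (countE n) t)
    {m : ℕ} {i : Fin n} {W : Finset Bool} {h k : ℕ} {v : Bool} (hh : n - 1 ≤ h)
    (hst : r.st m i = CountState.live W h k v) :
    CK (countE n) (Sys (countE n) t) (ExistsVal (countE n) v) r m := by
  refine CK.of_invariant (fun r m => r ∈ Sys (countE n) t ∧
    r.st m i = CountState.live W h k v) ?_ ?_ ⟨hr, hst⟩
  · rintro r m ⟨hr, hst⟩
    obtain ⟨val, hval⟩ := exists_st_eq_localState hr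
    replace hst := localState_eq_live.1 ((hval _ _).symm.trans hst)
    exact existsVal_of_mem_seen hval (hst.2.2.2.2 ▸ self_mem_seen r.env val m i)
  · rintro r m ⟨hr, hst⟩ j hj r' hr' m' he
    obtain ⟨val, hval⟩ := exists_st_eq_localState hr
    have hst' := hst
    replace hst' := localState_eq_live.1 ((hval _ _).symm.trans hst')
    replace hj := localState_ne_crashed.1 ((hval m j).symm.trans_ne hj)
    obtain rfl := eq_of_le_card_missing hr.1 hst'.1 (hst'.2.2.1 ▸ hh) hj
    exact ⟨hr', he ▸ hst⟩

/-- in the interpreted system of Counting FloodSet `E^{count}`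
under `Crash_t`, if agent `i`'s local state at `(r,m)` is `⟨W, h, m, v⟩`, then
`C_N(∃0) ∨ C_N(∃1)` holds at `(r,m)` iff `m ≥ min {t+1, n-1}` or `h ≥ n-1`. -/
theorem count_common_knowledge_iff
    {n t : ℕ} (ht : t < n) (r : Run (countE n)) (hr : r ∈ Sys (countE n) t)
    (m : ℕ) (i : Fin n) (W : Finset Bool) (h : ℕ) (v : Bool)
    (hst : r.st m i = CountState.live W h m v) :
    (CK (countE n) (Sys (countE n) t) (ExistsVal (countE n) false) r m ∨
     CK (countE n) (Sys (countE n) t) (ExistsVal (countE n) true) r m)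
    ↔ (min (t+1) (n-1) ≤ m ∨ n-1 ≤ h) := by
  obtain ⟨val, hval⟩ := exists_st_eq_localState hr
  have hs := hst
  replace hs := localState_eq_live.1 ((hval _ _).symm.trans hs)
  obtain ⟨-, hW, hh, -, hv⟩ := hs
  have hvW : v ∈ W := by rw [← hW, ← hv]; exact self_mem_seen _ _ _ _
  have hht : h ≤ t := hh ▸ hr.1.card_missing_le m i
  constructor
  · intro hck
    by_contra hc
    rw [not_or, not_le, not_le, lt_min_iff] at hc
    obtain ⟨⟨hmt, hmn⟩, hhn⟩ := hc
    have key : ∀ w, ¬ CK (countE n) (Sys (countE n) t) (ExistsVal (countE n) (!w)) r m := by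
      intro w hw
      have H : CKAt t m (ExistsVal (countE n) (!w)) i (.live W h m v) := ⟨r, hr, hst, hw⟩
      rcases eq_or_ne m 0 with rfl | hm
      · exact not_CKAt_zero (by omega) H
      · exact not_CKAt_pos hm (by omega) (by omega) hht (by omega) hvW H
    exact hck.elim (key true) (key false)
  · intro hmh
    have hck : CK (countE n) (Sys (countE n) t) (ExistsVal (countE n) v) r m :=
      hmh.elim (fun hm => CK_existsVal_of_min_le hr hm hst hvW)
        (fun hh => CK_existsVal_of_le_missing hr hh hst)
    cases v
    · exact Or.inl hck
    · exact Or.inr hck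

end SBA
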